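/- arXiv:1902.10337 — 3 statements merged into one kernel-verified Lean document; each statement's English description precedes it below -/
import Mathlib

section
/- Let G be a simple graph on n ≥ 3 vertices with a Hamiltonian cycle H, let L be any circle ordering of G, and let L^H be a Hamiltonian ordering of H. Then there exists a sequence of circle orderings L = L₀, L₁, …, L_ℓ, each obtained from the previous one by applying at most one κ-move and at most one γ-move, such that L_ℓ is equivalent to L^H and ℓ ≤ 3·Δ(L, H). In particular ℓ ≤ 4n, so that L^H is reachable from L by at most 8n generator moves (γ-moves and κ-moves), a number bounded above by a linear function of n. -/
variable {V : Type*}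

/-- The adjacent pairs of a circle ordering `L`: the unordered pairs
`{vᵢ, vᵢ₊₁}` (indices mod `L.length`). -/
def adjPairs (L : List V) : List (Sym2 V) :=
  (L.zip (L.rotate 1)).map (fun p => s(p.1, p.2))

/-- `L` is a circle ordering of the vertex set `V`: a list containing every
vertex exactly once, regarded cyclically. -/
def IsCircleOrdering [Fintype V] (L : List V) : Prop :=
  L.Nodup ∧ ∀ v : V, v ∈ L

/-- `g(L)`: the number of gaps of `L`, i.e. adjacent pairs of `L` that are
not edges of `G`. -/
noncomputable def numGaps (G : SimpleGraph V) (L : List V) : ℕ :=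
  (adjPairs L).countP (fun e => @decide (e ∉ G.edgeSet) (Classical.propDecidable _))

/-- `dist(L, H) = n - (number of adjacent pairs of `L` lying in the edge set `H`)`. -/
noncomputable def distTo (H : Set (Sym2 V)) (L : List V) : ℕ :=
  L.length - (adjPairs L).countP (fun e => @decide (e ∈ H) (Classical.propDecidable _))

/-- `Δ(L, H) = g(L)/3 + dist(L, H)`. -/
noncomputable def delta (G : SimpleGraph V) (H : Set (Sym2 V)) (L : List V) : ℚ :=
  (numGaps G L : ℚ) / 3 + (distTo H L : ℚ)

/-- Two circle orderings are equivalent iff one is obtained from the other by a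
cyclic rotation, a reversal of the order, or a composition of both. -/
def OrderEquiv (L M : List V) : Prop :=
  (∃ k, M = L.rotate k) ∨ (∃ k, M = L.reverse.rotate k)

/-- A γ-move maps an ordering `A ++ B` (with `A`, `B` nonempty) to
`A.reverse ++ B`. -/
def GammaMove (L M : List V) : Prop :=
  ∃ A B : List V, A ≠ [] ∧ B ≠ [] ∧ L = A ++ B ∧ M = A.reverse ++ B

/-- A κ-move maps an ordering `A ++ B ++ C ++ D` (with `A`, `B`, `D` nonempty,
`C` possibly empty) to `A.reverse ++ B.reverse ++ D ++ C.reverse`. -/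
def KappaMove (L M : List V) : Prop :=
  ∃ A B C D : List V, A ≠ [] ∧ B ≠ [] ∧ D ≠ [] ∧
    L = A ++ B ++ C ++ D ∧ M = A.reverse ++ B.reverse ++ D ++ C.reverse

/-- A γ-move applied up to equivalence: the ordering may first be replaced by
any equivalent ordering. -/
def GammaStep (L M : List V) : Prop := ∃ L', OrderEquiv L L' ∧ GammaMove L' M

/-- A κ-move applied up to equivalence. -/
def KappaStep (L M : List V) : Prop := ∃ L', OrderEquiv L L' ∧ KappaMove L' M

/-- `M` is obtained from `L` by applying at most one κ-move and at most one
γ-move (in some order), each up to equivalence. -/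
def KGStep (L M : List V) : Prop :=
  OrderEquiv L M ∨ GammaStep L M ∨ KappaStep L M ∨
    (∃ K, KappaStep L K ∧ GammaStep K M) ∨
    (∃ K, GammaStep L K ∧ KappaStep K M)

theorem OrderEquiv.refl (L : List V) : OrderEquiv L L := Or.inl ⟨0, by simp⟩

theorem OrderEquiv.trans {L M N : List V} (h₁ : OrderEquiv L M) (h₂ : OrderEquiv M N) :
    OrderEquiv L N := by
  have reverse_rotate : ∀ (l : List V) (k : ℕ), ∃ j, (l.rotate k).reverse = l.reverse.rotate j := by
    intro l k
    rw [List.reverse_rotate]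
    exact ⟨_, rfl⟩
  rcases h₁ with ⟨k, rfl⟩ | ⟨k, rfl⟩ <;> rcases h₂ with ⟨m, rfl⟩ | ⟨m, rfl⟩
  · exact Or.inl ⟨k + m, by rw [List.rotate_rotate]⟩
  · obtain ⟨j, hj⟩ := reverse_rotate L k
    exact Or.inr ⟨j + m, by rw [hj, List.rotate_rotate]⟩
  · exact Or.inr ⟨k + m, by rw [List.rotate_rotate]⟩
  · obtain ⟨j, hj⟩ := reverse_rotate L.reverse k
    exact Or.inl ⟨j + m, by rw [hj, List.rotate_rotate, List.reverse_reverse]⟩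

theorem OrderEquiv.append_comm (A B : List V) : OrderEquiv (A ++ B) (B ++ A) :=
  Or.inl ⟨A.length, by simp [List.rotate_append_length_eq]⟩

theorem OrderEquiv.cons_reverse (a : V) (l : List V) : OrderEquiv (a :: l) (a :: l.reverse) := by
  have h : OrderEquiv (a :: l) (l.reverse ++ [a]) := Or.inr ⟨0, by simp⟩
  exact h.trans (OrderEquiv.append_comm _ _)

/-- `M` is, up to equivalence, reachable from `L` by `k` steps. -/
def ReachIn (k : ℕ) (L M : List V) : Prop :=
  ∃ f : ℕ → List V, f 0 = L ∧ (∀ i < k, KGStep (f i) (f (i + 1))) ∧ OrderEquiv (f k) M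

theorem ReachIn.of_orderEquiv {L M : List V} (h : OrderEquiv L M) : ReachIn 0 L M :=
  ⟨fun _ => L, rfl, by simp, h⟩

theorem ReachIn.of_gammaStep {k : ℕ} {L M N : List V} (h : GammaStep L M) (hr : ReachIn k M N) :
    ReachIn (k + 1) L N := by
  obtain ⟨f, h0, hs, he⟩ := hr
  refine ⟨fun i => Nat.casesOn i L f, rfl, ?_, he⟩
  rintro (_ | i) hi
  · exact Or.inr (Or.inl (by simpa [h0] using h))
  · exact hs i (by omega)

theorem ReachIn.of_equiv_left {k : ℕ} {L M N : List V} (h : OrderEquiv L M) (hr : ReachIn k M N) :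
    ReachIn k L N := by
  obtain ⟨f, h0, hs, he⟩ := hr
  rcases k with _ | k
  · exact ReachIn.of_orderEquiv (h.trans (h0 ▸ he))
  · refine ⟨fun i => Nat.casesOn i L (fun j => f (j + 1)), rfl, ?_, he⟩
    rintro (_ | i) hi
    · have h1 := hs 0 (by omega)
      rw [h0] at h1
      change KGStep L (f 1)
      rcases h1 with h1 | ⟨K, hK, h1⟩ | ⟨K, hK, h1⟩ | ⟨K, ⟨K', hK, h1⟩, h2⟩ | ⟨K, ⟨K', hK, h1⟩, h2⟩
      · exact Or.inl (h.trans h1)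
      · exact Or.inr (Or.inl ⟨K, h.trans hK, h1⟩)
      · exact Or.inr (Or.inr (Or.inl ⟨K, h.trans hK, h1⟩))
      · exact Or.inr (Or.inr (Or.inr (Or.inl ⟨K, ⟨K', h.trans hK, h1⟩, h2⟩)))
      · exact Or.inr (Or.inr (Or.inr (Or.inr ⟨K, ⟨K', h.trans hK, h1⟩, h2⟩)))
    · exact hs (i + 1) (by omega)

/-- Reversing an inner segment costs one step. -/
theorem ReachIn.of_reverse_segment {k : ℕ} {Q M Y N : List V} (hQ : Q ≠ []) (hM : M ≠ [])
    (hr : ReachIn k (Q ++ M.reverse ++ Y) N) : ReachIn (k + 1) (Q ++ M ++ Y) N := by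
  have h₁ : OrderEquiv (Q ++ M ++ Y) (M ++ (Y ++ Q)) := by
    simpa using OrderEquiv.append_comm Q (M ++ Y)
  have h₂ : OrderEquiv (M.reverse ++ (Y ++ Q)) (Q ++ M.reverse ++ Y) := by
    simpa using OrderEquiv.append_comm (M.reverse ++ Y) Q
  exact ReachIn.of_gammaStep ⟨_, h₁, M, Y ++ Q, hM, by simp [hQ], rfl, rfl⟩ (hr.of_equiv_left h₂)

/-- The unordered pairs of consecutive entries of a list. -/
def pathPairs : List V → List (Sym2 V)
  | a :: b :: l => s(a, b) :: pathPairs (b :: l)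
  | _ => []

theorem pathPairs_append (l m : List V) (a b : V) :
    pathPairs (l ++ a :: b :: m) = pathPairs (l ++ [a]) ++ s(a, b) :: pathPairs (b :: m) := by
  induction l with
  | nil => simp [pathPairs]
  | cons c l ih =>
    rcases l with _ | ⟨d, l⟩
    · simp [pathPairs]
    · simpa [pathPairs] using ih

theorem pathPairs_reverse (l : List V) : pathPairs l.reverse = (pathPairs l).reverse := by
  induction l with
  | nil => rfl
  | cons a l ih =>
    rcases l with _ | ⟨b, l⟩
    · rfl
    · have h := pathPairs_append l.reverse [] b a
      simp only [List.reverse_cons, List.append_assoc, List.cons_append, List.nil_append] at h ih ⊢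
      rw [h, ih]
      simp [pathPairs, Sym2.eq_swap]

theorem mem_of_mem_pathPairs {l : List V} {e : Sym2 V} (he : e ∈ pathPairs l) {a : V}
    (ha : a ∈ e) : a ∈ l := by
  induction l with
  | nil => simp [pathPairs] at he
  | cons c l ih =>
    rcases l with _ | ⟨d, l⟩
    · simp [pathPairs] at he
    · rcases List.mem_cons.1 he with rfl | he
      · rcases Sym2.mem_iff.1 ha with rfl | rfl <;> simp
      · exact List.mem_cons_of_mem _ (ih he)

theorem eq_cons_of_mem_pathPairs {a y : V} {l : List V} (ha : a ∉ l)
    (h : s(a, y) ∈ pathPairs (a :: l)) : ∃ m, l = y :: m := by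
  rcases l with _ | ⟨b, l⟩
  · simp [pathPairs] at h
  · rcases List.mem_cons.1 h with h | h
    · exact ⟨l, by rw [Sym2.congr_right.1 h]⟩
    · exact absurd (mem_of_mem_pathPairs h (Sym2.mem_mk_left a y)) ha

theorem adjPairs_cons (a : V) (l : List V) : adjPairs (a :: l) = pathPairs (a :: l ++ [a]) := by
  have key : ∀ (l : List V) (b c : V),
      ((b :: l).zip (l ++ [c])).map (fun p => s(p.1, p.2)) = pathPairs (b :: l ++ [c]) := by
    intro l
    induction l with
    | nil => intro b c; simp [pathPairs]
    | cons d l ih => intro b c; simpa [pathPairs] using ih d c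
  simpa [adjPairs] using key l a a

theorem adjPairs_perm_append_singleton (a : V) (l : List V) :
    (adjPairs (l ++ [a])).Perm (adjPairs (a :: l)) := by
  rcases l with _ | ⟨b, l⟩
  · rfl
  · have h := pathPairs_append (b :: l) [] a b
    simp only [List.cons_append] at h
    rw [List.cons_append, adjPairs_cons, adjPairs_cons]
    simp only [List.cons_append, List.append_assoc, List.nil_append, h]
    simp [pathPairs]

theorem adjPairs_rotate_perm (l : List V) (k : ℕ) : (adjPairs (l.rotate k)).Perm (adjPairs l) := by
  induction k generalizing l with
  | zero => simp
  | succ k ih =>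
    rcases l with _ | ⟨a, l⟩
    · simp
    · rw [List.rotate_cons_succ]
      exact (ih _).trans (adjPairs_perm_append_singleton a l)

theorem adjPairs_reverse_perm (l : List V) : (adjPairs l.reverse).Perm (adjPairs l) := by
  rcases l with _ | ⟨a, l⟩
  · rfl
  · rw [List.reverse_cons]
    refine (adjPairs_perm_append_singleton a _).trans ?_
    rw [adjPairs_cons, adjPairs_cons]
    have h := pathPairs_reverse (a :: l ++ [a])
    have h' : (a :: l ++ [a]).reverse = a :: l.reverse ++ [a] := by simp
    rw [← h', h]
    exact List.reverse_perm _

theorem OrderEquiv.adjPairs_perm {L M : List V} (h : OrderEquiv L M) :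
    (adjPairs M).Perm (adjPairs L) := by
  rcases h with ⟨k, rfl⟩ | ⟨k, rfl⟩
  · exact adjPairs_rotate_perm L k
  · exact (adjPairs_rotate_perm _ k).trans (adjPairs_reverse_perm L)

theorem OrderEquiv.perm {L M : List V} (h : OrderEquiv L M) : M.Perm L := by
  rcases h with ⟨k, rfl⟩ | ⟨k, rfl⟩
  · exact List.rotate_perm L k
  · exact (List.rotate_perm _ k).trans (List.reverse_perm L)

/-- The number of consecutive pairs of a list that do not lie in `E`. -/
noncomputable def breaks (E : Set (Sym2 V)) (l : List V) : ℕ :=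
  (pathPairs l).countP (fun e => @decide (e ∉ E) (Classical.propDecidable _))

open Classical in
theorem breaks_append (E : Set (Sym2 V)) (l m : List V) (a b : V) :
    breaks E (l ++ a :: b :: m) =
      breaks E (l ++ [a]) + (if s(a, b) ∈ E then 0 else 1) + breaks E (b :: m) := by
  unfold breaks
  rw [pathPairs_append, List.countP_append, List.countP_cons]
  by_cases h : s(a, b) ∈ E <;> simp [h]
  omega

open Classical in
theorem breaks_cons_cons (E : Set (Sym2 V)) (a b : V) (l : List V) :
    breaks E (a :: b :: l) = (if s(a, b) ∈ E then 0 else 1) + breaks E (b :: l) := by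
  have h := breaks_append E [] l a b
  simpa [breaks, pathPairs] using h

theorem breaks_reverse (E : Set (Sym2 V)) (l : List V) : breaks E l.reverse = breaks E l := by
  unfold breaks
  rw [pathPairs_reverse, List.countP_reverse]

theorem breaks_append_le (E : Set (Sym2 V)) (l m : List V) :
    breaks E (l ++ m) ≤ breaks E l + 1 + breaks E m := by
  rcases l.eq_nil_or_concat with rfl | ⟨l, a, rfl⟩
  · simp
  · rcases m with _ | ⟨b, m⟩
    · simp; omega
    · have h := breaks_append E l m a b
      simp only [List.append_assoc, List.cons_append, List.nil_append, List.concat_eq_append] at h ⊢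
      rw [h]
      split_ifs <;> omega

theorem breaks_congr {E F : Set (Sym2 V)} {l : List V}
    (h : ∀ e ∈ pathPairs l, e ∈ E ↔ e ∈ F) : breaks E l = breaks F l := by
  unfold breaks
  refine List.countP_congr fun e he => ?_
  simp [h e he]

/-- The maximal initial segment without breaks. -/
theorem exists_initial_block (E : Set (Sym2 V)) (a : V) (l : List V) :
    ∃ B Z, l = B ++ Z ∧ breaks E (a :: B) = 0 ∧
      (Z = [] ∨ breaks E (a :: l) = 1 + breaks E Z) := by
  induction l generalizing a with
  | nil => exact ⟨[], [], rfl, by simp [breaks, pathPairs], Or.inl rfl⟩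
  | cons b l ih =>
    by_cases h : s(a, b) ∈ E
    · obtain ⟨B, Z, rfl, hB, hZ⟩ := ih b
      refine ⟨b :: B, Z, rfl, by simp [breaks_cons_cons, h, hB], ?_⟩
      exact hZ.imp id fun hZ => by simpa [breaks_cons_cons, h] using hZ
    · exact ⟨[], b :: l, rfl, by simp [breaks, pathPairs], Or.inr (by simp [breaks_cons_cons, h])⟩

/-- The vertex following `p` in the target path can be brought next to `p` in at most two
segment reversals per removed break. -/
theorem exists_reachIn_of_next {Q X Y S : List V} {p s : V} (hX : X ≠ [])
    (hnd : (p :: (X ++ s :: Y)).Nodup) (hS : (p :: s :: S).Nodup) :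
    ∃ R, (s :: R).Perm (X ++ s :: Y) ∧
      breaks {e | e ∈ pathPairs (p :: s :: S)} (p :: s :: R) + 1 ≤
        breaks {e | e ∈ pathPairs (p :: s :: S)} (p :: (X ++ s :: Y)) ∧
      ∀ k N, ReachIn k (Q ++ p :: s :: R) N →
        ∃ j ≤ k + 2, ReachIn j (Q ++ p :: (X ++ s :: Y)) N := by
  set E : Set (Sym2 V) := {e | e ∈ pathPairs (p :: s :: S)} with hE
  obtain ⟨x, X', hxX⟩ := List.exists_cons_of_ne_nil hX
  obtain ⟨X'', u, huX⟩ := (List.eq_nil_or_concat X).resolve_left hX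
  rw [List.concat_eq_append] at huX
  have hxs : x ≠ s := by
    rintro rfl
    subst hxX
    simp at hnd
  have hpx : s(p, x) ∉ E := by
    intro h
    obtain ⟨m, hm⟩ := eq_cons_of_mem_pathPairs (by simp_all) h
    exact hxs (List.cons.inj hm).1.symm
  have hps : s(p, s) ∈ E := by simp [hE, pathPairs]
  have hold : breaks E (p :: (X ++ s :: Y)) = 1 + breaks E (X ++ s :: Y) := by
    rw [hxX, List.cons_append, breaks_cons_cons, if_neg hpx]
  have hmid : breaks E (X ++ s :: Y) =
      breaks E X + (@ite ℕ (s(u, s) ∈ E) (Classical.propDecidable _) 0 1) + breaks E (s :: Y) := by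
    rw [huX]
    simpa using breaks_append E X'' Y u s
  have hXr : X.reverse = u :: X''.reverse := by rw [huX]; simp
  have hnew : ∀ R, breaks E (p :: s :: R) = breaks E (s :: R) := by
    intro R
    rw [breaks_cons_cons, if_pos hps, zero_add]
  by_cases hB : ∃ y Y', Y = y :: Y' ∧ s(s, y) ∈ E
  · obtain ⟨y, Y', hY, hsy⟩ := hB
    have hE' : ∀ z, z ≠ p → s(s, z) ∈ E → ∃ m, S = z :: m := by
      intro z hz h
      rcases List.mem_cons.1 h with h | h
      · rw [Sym2.eq_iff] at h
        rcases h with ⟨h, -⟩ | ⟨-, h⟩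
        · subst h; simp at hS
        · exact absurd h hz
      · exact eq_cons_of_mem_pathPairs (by simp_all) h
    have hus : s(u, s) ∉ E := by
      intro h
      rw [Sym2.eq_swap] at h
      obtain ⟨m, hm⟩ := hE' u (by rintro rfl; simp [huX] at hnd) h
      obtain ⟨m', hm'⟩ := hE' y (by rintro rfl; simp [hY] at hnd) hsy
      have huy : u = y := (List.cons.inj (hm.symm.trans hm')).1
      subst huy
      rw [huX, hY] at hnd
      simp [List.nodup_append] at hnd
    obtain ⟨B, Z, hBZ, hB0, hZ⟩ := exists_initial_block E s Y
    refine ⟨B ++ (X.reverse ++ Z), ?_, ?_, ?_⟩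
    · rw [hBZ]
      classical
      rw [List.perm_iff_count]
      intro c
      simp [List.count_append, List.count_cons]
      omega
    · rw [hnew, hold, hmid, if_neg hus]
      have h1 := breaks_append_le E (s :: B) (X.reverse ++ Z)
      have h2 := breaks_append_le E X.reverse Z
      have h3 := breaks_reverse E X
      rw [List.cons_append] at h1
      rcases hZ with rfl | hZ
      · simp only [List.append_nil] at h1 h2 ⊢
        omega
      · omega
    · intro k N hr
      refine ⟨k + 2, le_rfl, ?_⟩
      have h1 : ReachIn (k + 1) ((Q ++ [p]) ++ (s :: B).reverse ++ (X.reverse ++ Z)) N :=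
        ReachIn.of_reverse_segment (by simp) (by simp) (by simpa using hr)
      have h2 : ReachIn (k + 2) ((Q ++ [p]) ++ (X ++ s :: B) ++ Z) N :=
        ReachIn.of_reverse_segment (by simp) (by simp) (by simpa using h1)
      simpa [hBZ] using h2
  · refine ⟨X.reverse ++ Y, ?_, ?_, ?_⟩
    · classical
      rw [List.perm_iff_count]
      intro c
      simp [List.count_append, List.count_cons]
      omega
    · have h0 : breaks E (s :: (X.reverse ++ Y)) =
          (@ite ℕ (s(u, s) ∈ E) (Classical.propDecidable _) 0 1) + breaks E (X.reverse ++ Y) := by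
        rw [hXr, List.cons_append, breaks_cons_cons, Sym2.eq_swap]
      have h3 := breaks_reverse E X
      rw [hnew, hold, hmid, h0]
      rcases Y with _ | ⟨y, Y⟩
      · simp only [List.append_nil]
        omega
      · have h2 := breaks_append_le E X.reverse (y :: Y)
        have hsy : s(s, y) ∉ E := fun h => hB ⟨y, Y, rfl, h⟩
        rw [breaks_cons_cons E s y, if_neg hsy]
        omega
    · intro k N hr
      refine ⟨k + 1, by omega, ?_⟩
      have h2 : ReachIn (k + 1) ((Q ++ [p]) ++ (X ++ [s]) ++ Y) N :=
        ReachIn.of_reverse_segment (by simp) (by simp) (by simpa using hr)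
      simpa using h2

/-- A path can be sorted into another one on the same vertices, fixing a common initial part,
with at most two steps per break. -/
theorem exists_reachIn_le_breaks (S : List V) (Q R : List V) (p : V) (hnd : (p :: R).Nodup)
    (hperm : R.Perm S) :
    ∃ k ≤ 2 * breaks {e | e ∈ pathPairs (p :: S)} (p :: R), ReachIn k (Q ++ p :: R) (Q ++ p :: S) := by
  induction S generalizing Q R p with
  | nil =>
    rw [hperm.eq_nil]
    exact ⟨0, Nat.zero_le _, ReachIn.of_orderEquiv (OrderEquiv.refl _)⟩
  | cons s S ih =>
    have hS : (p :: s :: S).Nodup := ((hperm.cons p).nodup_iff).1 hnd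
    have extend : ∀ R', (s :: R').Perm (s :: S) →
        ∃ k ≤ 2 * breaks {e | e ∈ pathPairs (p :: s :: S)} (p :: s :: R'),
          ReachIn k (Q ++ p :: s :: R') (Q ++ p :: s :: S) := by
      intro R' hR'
      have hnd' : (p :: s :: R').Nodup := ((hR'.cons p).nodup_iff).2 hS
      obtain ⟨k, hk, hr⟩ := ih (Q ++ [p]) R' s hnd'.of_cons hR'.cons_inv
      refine ⟨k, ?_, by simpa using hr⟩
      have hps : s(p, s) ∈ {e | e ∈ pathPairs (p :: s :: S)} := by simp [pathPairs]
      rw [breaks_cons_cons, if_pos hps, zero_add]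
      refine hk.trans_eq (congrArg _ (breaks_congr fun e he => ?_))
      refine ⟨fun h => List.mem_cons_of_mem _ h, fun h => ?_⟩
      rcases List.mem_cons.1 h with rfl | h
      · exact absurd (mem_of_mem_pathPairs he (Sym2.mem_mk_left p s)) (List.nodup_cons.1 hnd').1
      · exact h
    obtain ⟨X, Y, rfl⟩ := List.append_of_mem (hperm.mem_iff.2 (List.mem_cons_self (a := s) (l := S)))
    by_cases hX : X = []
    · subst hX
      exact extend Y hperm
    · obtain ⟨R', hR', hb, hr⟩ := exists_reachIn_of_next (Q := Q) hX hnd hS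
      obtain ⟨k, hk, hk'⟩ := extend R' (hR'.trans hperm)
      obtain ⟨j, hj, hj'⟩ := hr k _ hk'
      exact ⟨j, by omega, hj'⟩

theorem length_adjPairs (L : List V) : (adjPairs L).length = L.length := by
  simp [adjPairs]

theorem distTo_eq_countP (H : Set (Sym2 V)) (L : List V) :
    distTo H L =
      (adjPairs L).countP (fun e => @decide (e ∉ H) (Classical.propDecidable _)) := by
  classical
  unfold distTo
  have h := List.length_eq_countP_add_countP
    (fun e => @decide (e ∈ H) (Classical.propDecidable _)) (l := adjPairs L)
  rw [length_adjPairs] at h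
  have h' : (adjPairs L).countP (fun e => @decide (e ∉ H) (Classical.propDecidable _)) =
      (adjPairs L).countP
        (fun a => decide ¬(@decide (a ∈ H) (Classical.propDecidable _)) = true) := by
    refine List.countP_congr fun e _ => ?_
    simp
  omega

/-- A cyclic ordering may be read from `w` in a direction in which `w` is not followed by `z`. -/
theorem exists_orderEquiv_cons {L : List V} (hnd : L.Nodup) (hlen : 3 ≤ L.length) {w : V}
    (hw : w ∈ L) (z : V) : ∃ x R, x ≠ z ∧ OrderEquiv L (w :: x :: R) := by
  obtain ⟨A, B, rfl⟩ := List.append_of_mem hw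
  have h₁ : OrderEquiv (A ++ w :: B) (w :: (B ++ A)) := OrderEquiv.append_comm _ _
  have h₂ := h₁.trans (OrderEquiv.cons_reverse w (B ++ A))
  have hnd' := (h₁.perm.nodup_iff).2 hnd
  have hlen' := h₁.perm.length_eq
  generalize B ++ A = R at *
  rcases R with _ | ⟨x, R⟩
  · simp only [List.length_cons, List.length_nil] at hlen' hlen; omega
  rcases R.eq_nil_or_concat with rfl | ⟨R, y, rfl⟩
  · simp only [List.length_cons, List.length_nil] at hlen' hlen; omega
  by_cases hx : x = z
  · refine ⟨y, (x :: R).reverse, ?_, by simpa using h₂⟩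
    rintro rfl
    simp [hx] at hnd'
  · exact ⟨x, _, hx, h₁⟩

/-- Reading `L` from the first vertex of the target so that it does not begin with the closing
pair of the target, the breaks of `L` are bounded by its distance to the target. -/
theorem breaks_le_distTo {L S R : List V} {w x z : V} (hx : x ≠ z) (hnd : (w :: x :: R).Nodup)
    (hL : OrderEquiv L (w :: x :: R)) (hz : ∃ S', S = S' ++ [z]) :
    breaks {e | e ∈ pathPairs (w :: S)} (w :: x :: R) ≤
      distTo {e | e ∈ adjPairs (w :: S)} L := by
  obtain ⟨S', rfl⟩ := hz
  have hadj : adjPairs (w :: (S' ++ [z])) = pathPairs (w :: (S' ++ [z])) ++ [s(z, w)] := by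
    rw [adjPairs_cons]
    simpa [pathPairs] using pathPairs_append (w :: S') [] z w
  have hb : breaks {e | e ∈ pathPairs (w :: (S' ++ [z]))} (w :: x :: R) =
      breaks {e | e ∈ adjPairs (w :: (S' ++ [z]))} (w :: x :: R) := by
    refine breaks_congr fun e he => ?_
    simp only [Set.mem_ofPred_eq, hadj, List.mem_append, List.mem_singleton]
    refine ⟨Or.inl, fun h => h.resolve_right ?_⟩
    rintro rfl
    rw [Sym2.eq_swap] at he
    obtain ⟨m, hm⟩ := eq_cons_of_mem_pathPairs (List.nodup_cons.1 hnd).1 he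
    exact hx (List.cons.inj hm).1
  rw [hb, distTo_eq_countP, ← hL.adjPairs_perm.countP_eq, adjPairs_cons w (x :: R)]
  unfold breaks
  obtain ⟨R', y, hy⟩ := (List.eq_nil_or_concat (w :: x :: R)).resolve_left (by simp)
  rw [List.concat_eq_append] at hy
  have h := pathPairs_append R' [] y w
  rw [hy, List.append_assoc, List.cons_append, List.nil_append, h, List.countP_append]
  exact Nat.le_add_right _ _

/-- any Hamiltonian ordering `LH` of a Hamiltonian cycle `H` is
reachable from any circle ordering `L` by a sequence of at most `3·Δ(L,H)`
steps, each consisting of at most one κ-move and at most one γ-move; in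
particular at most `4n` such steps (hence at most `8n` generator moves). -/
theorem stmt6 [Fintype V] [DecidableEq V] (G : SimpleGraph V)
    (hn : 3 ≤ Fintype.card V)
    {v : V} (p : G.Walk v v) (hp : p.IsHamiltonianCycle)
    (L LH : List V) (hL : IsCircleOrdering L) (hLH : IsCircleOrdering LH)
    (hHam : {e | e ∈ adjPairs LH} = {e | e ∈ p.edges}) :
    ∃ (ℓ : ℕ) (f : ℕ → List V), f 0 = L ∧
      (∀ i < ℓ, KGStep (f i) (f (i + 1))) ∧
      OrderEquiv (f ℓ) LH ∧
      (ℓ : ℚ) ≤ 3 * delta G {e | e ∈ p.edges} L ∧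
      ℓ ≤ 4 * Fintype.card V := by
  have length_eq : ∀ {M : List V}, IsCircleOrdering M → M.length = Fintype.card V := by
    intro M hM
    rw [← List.toFinset_card_of_nodup hM.1, ← Finset.card_univ]
    congr 1
    ext a
    simp [hM.2 a]
  have hlenH := length_eq hLH
  have hlen := length_eq hL
  rcases LH with _ | ⟨w, S⟩
  · simp only [List.length_nil] at hlenH; omega
  rcases S.eq_nil_or_concat with rfl | ⟨S', z, hz⟩
  · simp only [List.length_cons, List.length_nil] at hlenH; omega
  rw [List.concat_eq_append] at hz
  obtain ⟨x, R, hx, hLR⟩ := exists_orderEquiv_cons hL.1 (by omega) (hL.2 w) z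
  have hnd : (w :: x :: R).Nodup := (hLR.perm.nodup_iff).2 hL.1
  have hperm : (w :: x :: R).Perm (w :: S) :=
    hLR.perm.trans ((List.perm_ext_iff_of_nodup hL.1 hLH.1).2 fun a => by simp [hL.2 a, hLH.2 a])
  obtain ⟨k, hk, hr⟩ := exists_reachIn_le_breaks S [] (x :: R) w hnd hperm.cons_inv
  have hd := breaks_le_distTo hx hnd hLR ⟨S', hz⟩
  rw [hHam] at hd
  obtain ⟨f, h0, hs, he⟩ := hr.of_equiv_left hLR
  have hdn : distTo {e | e ∈ p.edges} L ≤ Fintype.card V := hlen ▸ Nat.sub_le _ _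
  refine ⟨k, f, h0, hs, he, ?_, by omega⟩
  have hkd : k ≤ 2 * distTo {e | e ∈ p.edges} L := by omega
  have hkd' : (k : ℚ) ≤ 2 * (distTo {e | e ∈ p.edges} L : ℚ) := by exact_mod_cast hkd
  have hg : (0 : ℚ) ≤ numGaps G L := Nat.cast_nonneg _
  have hd0 : (0 : ℚ) ≤ distTo {e | e ∈ p.edges} L := Nat.cast_nonneg _
  unfold delta
  linarith
end

section
/- (SLH floating 2-flo.) Let G be a simple graph on n ≥ 3 vertices and let L be a circle ordering of G written cyclically as L = X ++ Y, where X = (x, …, b) and Y = (a, …, y) are nonempty segments (possibly of length one, in which case x = b or a = y). Suppose {y, x} is a gap of L and {x, a} is an edge of G. Then the circle ordering L′ = X.reverse ++ Y = (b, …, x, a, …, y) satisfies g(L′) ≤ g(L); if moreover {b, y} is an edge of G, then g(L′) ≤ g(L) − 1. -/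
variable {V : Type*}

/-- The unordered pairs of consecutive entries of a list, read linearly. -/
def consecutivePairs : List V → List (Sym2 V)
  | [] => []
  | [_] => []
  | v :: w :: l => s(v, w) :: consecutivePairs (w :: l)

theorem consecutivePairs_append {X Y : List V} {b a : V}
    (hb : X.getLast? = some b) (ha : Y.head? = some a) :
    consecutivePairs (X ++ Y) = consecutivePairs X ++ s(b, a) :: consecutivePairs Y := by
  induction X with
  | nil => simp at hb
  | cons v t ih =>
    cases t with
    | nil =>
      cases Y with
      | nil => simp at ha
      | cons c l =>
        simp only [List.getLast?_singleton, List.head?_cons, Option.some.injEq] at hb ha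
        subst hb ha
        rfl
    | cons w t =>
      have := ih (by simpa [List.getLast?_cons_cons] using hb)
      simpa [consecutivePairs] using this

theorem consecutivePairs_reverse (L : List V) :
    consecutivePairs L.reverse = (consecutivePairs L).reverse := by
  induction L with
  | nil => rfl
  | cons v t ih =>
    cases t with
    | nil => rfl
    | cons w t =>
      rw [List.reverse_cons, consecutivePairs_append (b := w) (a := v) (by simp) (by simp), ih]
      simp [consecutivePairs, Sym2.eq_swap]

theorem map_zip_append_singleton (v z : V) (l : List V) :
    ((v :: l).zip (l ++ [z])).map (fun p => s(p.1, p.2)) =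
      consecutivePairs (v :: l ++ [z]) := by
  induction l generalizing v with
  | nil => rfl
  | cons w l ih => simpa [consecutivePairs] using ih w

theorem adjPairs_eq_consecutivePairs_append {L : List V} {x y : V}
    (hx : L.head? = some x) (hy : L.getLast? = some y) :
    adjPairs L = consecutivePairs L ++ [s(y, x)] := by
  cases L with
  | nil => simp at hx
  | cons v l =>
    obtain rfl : v = x := by simpa using hx
    rw [adjPairs, List.rotate_cons_succ, List.rotate_zero, map_zip_append_singleton,
      consecutivePairs_append hy (Y := [v]) rfl]
    rfl

theorem adjPairs_append {X Y : List V} {x b a y : V}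
    (hx : X.head? = some x) (hb : X.getLast? = some b)
    (ha : Y.head? = some a) (hy : Y.getLast? = some y) :
    adjPairs (X ++ Y) =
      (consecutivePairs X ++ s(b, a) :: consecutivePairs Y) ++ [s(y, x)] := by
  rw [adjPairs_eq_consecutivePairs_append (x := x) (y := y) (by simp [hx]) (by simp [hy]),
    consecutivePairs_append hb ha]

/-- SLH floating 2-flo: if `{y,x}` is a gap of
`L = (x,…,b) ++ (a,…,y)` and `{x,a}` is an edge of `G`, then reversing the
first segment does not increase the number of gaps; if moreover `{b,y}` is an
edge of `G`, it reduces the number of gaps by at least 1. -/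
theorem stmt10 [Fintype V] (G : SimpleGraph V) (hn : 3 ≤ Fintype.card V)
    (X Y : List V) (x b a y : V)
    (hX : X ≠ []) (hY : Y ≠ [])
    (hx : X.head? = some x) (hb : X.getLast? = some b)
    (ha : Y.head? = some a) (hy : Y.getLast? = some y)
    (hL : IsCircleOrdering (X ++ Y))
    (hgap : s(y, x) ∉ G.edgeSet)
    (hedge : s(x, a) ∈ G.edgeSet) :
    numGaps G (X.reverse ++ Y) ≤ numGaps G (X ++ Y) ∧
      (s(b, y) ∈ G.edgeSet →
        numGaps G (X.reverse ++ Y) + 1 ≤ numGaps G (X ++ Y)) := by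
  have hL' := adjPairs_append (X := X.reverse) (x := b) (b := x)
    (by simpa using hb) (by simpa using hx) ha hy
  rw [consecutivePairs_reverse] at hL'
  rw [Sym2.eq_swap (a := b)]
  simp only [numGaps, hL', adjPairs_append hx hb ha hy, List.countP_append, List.countP_cons,
    List.countP_reverse, List.countP_nil, decide_eq_true_eq, hgap, hedge, not_true_eq_false,
    not_false_eq_true, if_true, if_false]
  constructor
  · split_ifs <;> omega
  · intro h
    simp only [h, not_true_eq_false, decide_eq_true_eq, if_false]
    omega
end

section
/- (SLH floating 4-flo type 2.) Let G be a simple graph on n ≥ 3 vertices and let L be a circle ordering of G written cyclically as L = A ++ B ++ C ++ D, where A = (x, …, e), B = (c, …, a), C = (b, …, f) and D = (d, …, y) are nonempty segments (possibly of length one). Suppose {y, x} is a gap of L, {x, a} and {c, d} are edges of G, and at least one of {e, b} and {f, y} is an edge of G. Then the circle ordering L′ = A.reverse ++ B.reverse ++ D ++ C.reverse = (e, …, x, a, …, c, d, …, y, f, …, b) satisfies g(L′) ≤ g(L); if both {e, b} and {f, y} are edges of G, then g(L′) ≤ g(L) − 1. -/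
variable {V : Type*}

open Classical in
/-- The indicator of `{u, v}` being a gap. -/
noncomputable def gapIndicator (G : SimpleGraph V) (u v : V) : ℕ :=
  if s(u, v) ∈ G.edgeSet then 0 else 1

/-- The number of gaps between consecutive entries of a list, not regarded cyclically. -/
noncomputable def pathGaps (G : SimpleGraph V) : List V → ℕ
  | [] => 0
  | [_] => 0
  | u :: v :: l => gapIndicator G u v + pathGaps G (v :: l)

lemma gapIndicator_comm (G : SimpleGraph V) (u v : V) :
    gapIndicator G u v = gapIndicator G v u := by
  rw [gapIndicator, gapIndicator, Sym2.eq_swap]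

lemma pathGaps_append (G : SimpleGraph V) {l m : List V} {u v : V}
    (hu : l.getLast? = some u) (hv : m.head? = some v) :
    pathGaps G (l ++ m) = pathGaps G l + gapIndicator G u v + pathGaps G m := by
  obtain ⟨m, rfl⟩ := List.head?_eq_some_iff.mp hv
  induction l with
  | nil => simp at hu
  | cons w l ih =>
    cases l with
    | nil =>
      obtain rfl : w = u := by simpa using hu
      simp [pathGaps]
    | cons z l =>
      have := ih (by simpa using hu)
      simp only [List.cons_append, pathGaps] at this ⊢
      omega

lemma pathGaps_reverse (G : SimpleGraph V) (l : List V) :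
    pathGaps G l.reverse = pathGaps G l := by
  induction l with
  | nil => rfl
  | cons u l ih =>
    cases l with
    | nil => rfl
    | cons v l =>
      rw [List.reverse_cons, pathGaps_append G (u := v) (v := u) (by simp) (by simp), ih,
        gapIndicator_comm]
      simp only [pathGaps]
      omega

lemma countP_zip_eq_pathGaps (G : SimpleGraph V) (u w : V) (l : List V) :
    (((u :: l).zip (l ++ [w])).map (fun p => s(p.1, p.2))).countP
      (fun e => @decide (e ∉ G.edgeSet) (Classical.propDecidable _)) =
    pathGaps G (u :: (l ++ [w])) := by
  induction l generalizing u with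
  | nil =>
    by_cases h : G.Adj u w <;> simp [pathGaps, gapIndicator, h]
  | cons v l ih =>
    have := ih v
    rw [List.cons_append, List.zip_cons_cons, List.map_cons, List.countP_cons, this]
    by_cases h : G.Adj u v <;> simp [pathGaps, gapIndicator, h, add_comm]

lemma numGaps_eq_pathGaps_add (G : SimpleGraph V) {l : List V} {u v : V}
    (hu : l.head? = some u) (hv : l.getLast? = some v) :
    numGaps G l = pathGaps G l + gapIndicator G v u := by
  obtain ⟨l, rfl⟩ := List.head?_eq_some_iff.mp hu
  have h := countP_zip_eq_pathGaps G u u l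
  rw [← List.cons_append, pathGaps_append G (v := u) hv (by simp)] at h
  simpa [numGaps, adjPairs, pathGaps] using h

lemma numGaps_append_four (G : SimpleGraph V) {A B C D : List V} {x e c a b f d y : V}
    (hx : A.head? = some x) (he : A.getLast? = some e)
    (hc : B.head? = some c) (ha : B.getLast? = some a)
    (hb : C.head? = some b) (hf : C.getLast? = some f)
    (hd : D.head? = some d) (hy : D.getLast? = some y) :
    numGaps G (A ++ B ++ C ++ D) =
      pathGaps G A + pathGaps G B + pathGaps G C + pathGaps G D +
        gapIndicator G e c + gapIndicator G a b + gapIndicator G f d + gapIndicator G y x := by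
  rw [numGaps_eq_pathGaps_add G (u := x) (v := y) (by simp [hx]) (by simp [hy]),
    pathGaps_append G (u := f) (by simp [hf]) hd,
    pathGaps_append G (u := a) (by simp [ha]) hb, pathGaps_append G he hc]
  omega

/-- SLH floating 4-flo type 2: for
`L = (x,…,e) ++ (c,…,a) ++ (b,…,f) ++ (d,…,y)` with gap `{y,x}`, edges `{x,a}`
and `{c,d}`, and at least one of `{e,b}`, `{f,y}` an edge, the ordering
`(e,…,x,a,…,c,d,…,y,f,…,b)` has no more gaps; if both `{e,b}` and `{f,y}` are
edges, it has at least one gap fewer. -/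
theorem stmt13 [Fintype V] (G : SimpleGraph V) (hn : 3 ≤ Fintype.card V)
    (A B C D : List V) (x e c a b f d y : V)
    (hA : A ≠ []) (hB : B ≠ []) (hC : C ≠ []) (hD : D ≠ [])
    (hx : A.head? = some x) (he : A.getLast? = some e)
    (hc : B.head? = some c) (ha : B.getLast? = some a)
    (hb : C.head? = some b) (hf : C.getLast? = some f)
    (hd : D.head? = some d) (hy : D.getLast? = some y)
    (hL : IsCircleOrdering (A ++ B ++ C ++ D))
    (hgap : s(y, x) ∉ G.edgeSet)
    (hedge1 : s(x, a) ∈ G.edgeSet) (hedge2 : s(c, d) ∈ G.edgeSet)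
    (hor : s(e, b) ∈ G.edgeSet ∨ s(f, y) ∈ G.edgeSet) :
    numGaps G (A.reverse ++ B.reverse ++ D ++ C.reverse) ≤
        numGaps G (A ++ B ++ C ++ D) ∧
      (s(e, b) ∈ G.edgeSet → s(f, y) ∈ G.edgeSet →
        numGaps G (A.reverse ++ B.reverse ++ D ++ C.reverse) + 1 ≤
          numGaps G (A ++ B ++ C ++ D)) := by
  rw [numGaps_append_four G hx he hc ha hb hf hd hy,
    numGaps_append_four G (x := e) (e := x) (c := a) (a := c) (b := d) (f := y) (d := f) (y := b)
      (by simpa using he) (by simpa using hx) (by simpa using ha) (by simpa using hc)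
      hd hy (by simpa using hf) (by simpa using hb)]
  simp only [pathGaps_reverse]
  rw [gapIndicator_comm G y f, gapIndicator_comm G b e]
  have hyx : gapIndicator G y x = 1 := if_neg hgap
  have hxa : gapIndicator G x a = 0 := if_pos hedge1
  have hcd : gapIndicator G c d = 0 := if_pos hedge2
  have hle : ∀ u v, gapIndicator G u v ≤ 1 := fun u v => by
    unfold gapIndicator; split <;> simp
  have heb := hle e b
  have hfy := hle f y
  constructor
  · rcases hor with h | h
    · have : gapIndicator G e b = 0 := if_pos h
      omega
    · have : gapIndicator G f y = 0 := if_pos h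
      omega
  · intro h₁ h₂
    have : gapIndicator G e b = 0 := if_pos h₁
    have : gapIndicator G f y = 0 := if_pos h₂
    omega
end
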